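/- arXiv:2106.11544 — 2 statements merged into one kernel-verified Lean document; each statement's English description precedes it below -/
import Mathlib

section
/- Let f : 𝔸² → 𝔸² over ℚ be given by f(x, y) = (xy, x² + xy), let (F_n) be the Fibonacci sequence with F₀ = 0, F₁ = 1, and define a_{−1} = (0, 0), a₀ = (0, 1), and a_n = ((−1)^{n+1} F_n, (−1)^n F_{n−1}) for n ≥ 1. Then for all n ≥ 1, f^{n+1}(a_n) = f^{n+1}(a_{n−1}) but f^{n}(a_n) ≠ f^{n}(a_{n−1}). In particular, there is no non-negative integer s₀ such that for all x, y ∈ 𝔸²(ℚ), f^{s}(x) = f^{s}(y) for some s ≥ 0 implies f^{s₀}(x) = f^{s₀}(y). -/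
/-!
STATEMENT 16: With `f(x,y) = (xy, x² + xy)` on `𝔸²(ℚ)` and the points `aₙ` built from the
Fibonacci numbers as in the paper, for all `n ≥ 1` we have
`f^{n+1}(aₙ) = f^{n+1}(a_{n−1})` but `f^{n}(aₙ) ≠ f^{n}(a_{n−1})`.  In particular there is no
`s₀ ≥ 0` such that `f^{s}(x) = f^{s}(y)` for some `s ≥ 0` implies `f^{s₀}(x) = f^{s₀}(y)`.
-/

/-- The self-map `f(x, y) = (xy, x² + xy)` of `𝔸²(ℚ) = ℚ²`. -/
def fMap : ℚ × ℚ → ℚ × ℚ := fun q => (q.1 * q.2, q.1 ^ 2 + q.1 * q.2)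

/-- The sequence of points `a₋₁ = (0,0)`, `a₀ = (0,1)`,
`aₙ = ((−1)^{n+1} Fₙ, (−1)^n F_{n−1})` for `n ≥ 1`, indexed by `ℤ`. -/
noncomputable def aSeq : ℤ → ℚ × ℚ := fun n =>
  if n = -1 then (0, 0)
  else if n = 0 then (0, 1)
  else ((-1 : ℚ) ^ (n + 1) * (Nat.fib n.toNat : ℚ), (-1 : ℚ) ^ n * (Nat.fib (n - 1).toNat : ℚ))

theorem fMap_smul (c : ℚ) (q : ℚ × ℚ) : fMap (c • q) = c ^ 2 • fMap q := by
  ext <;> simp [fMap] <;> ring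

theorem aSeq_zero : aSeq 0 = (0, 1) := by
  simp [aSeq]

theorem aSeq_natCast_succ (n : ℕ) :
    aSeq ((n + 1 : ℕ) : ℤ) =
      ((-1 : ℚ) ^ n * (Nat.fib (n + 1) : ℚ), (-1 : ℚ) ^ (n + 1) * (Nat.fib n : ℚ)) := by
  have h₁ : ((n + 1 : ℕ) : ℤ) ≠ -1 := by omega
  have h₂ : ((n + 1 : ℕ) : ℤ) ≠ 0 := by omega
  have h₃ : (((n + 1 : ℕ) : ℤ) - 1).toNat = n := by omega
  have h₄ : ((n + 1 : ℕ) : ℤ) + 1 = ((n + 2 : ℕ) : ℤ) := by push_cast; ring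
  rw [aSeq, if_neg h₁, if_neg h₂, h₃, h₄, zpow_natCast, zpow_natCast, Int.toNat_natCast]
  ext <;> simp [pow_succ]

theorem fMap_aSeq_succ (n : ℕ) :
    fMap (aSeq ((n + 1 : ℕ) : ℤ)) = ((-1 : ℚ) ^ n * (Nat.fib (n + 1) : ℚ)) • aSeq (n : ℤ) := by
  rw [aSeq_natCast_succ]
  cases n with
  | zero => simp [fMap, aSeq_zero]
  | succ m =>
    rw [aSeq_natCast_succ]
    have h : (Nat.fib (m + 1 + 1) : ℚ) = Nat.fib m + Nat.fib (m + 1) := by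
      exact_mod_cast Nat.fib_add_two
    ext <;> simp only [fMap, Prod.smul_mk, smul_eq_mul, h] <;> ring

theorem exists_iterate_fMap_smul_aSeq (n : ℕ) {c : ℚ} (hc : c ≠ 0) :
    ∃ d : ℚ, d ≠ 0 ∧ fMap^[n] (c • aSeq n) = (0, d) := by
  induction n generalizing c with
  | zero => exact ⟨c, hc, by simp [aSeq_zero]⟩
  | succ n ih =>
    have hfib : (Nat.fib (n + 1) : ℚ) ≠ 0 := by
      exact_mod_cast (Nat.fib_pos.2 n.succ_pos).ne'
    rw [Function.iterate_succ_apply, fMap_smul, fMap_aSeq_succ, smul_smul]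
    exact ih (mul_ne_zero (pow_ne_zero _ hc) (mul_ne_zero (pow_ne_zero _ (by norm_num)) hfib))

theorem exists_iterate_fMap_aSeq (n : ℕ) :
    ∃ d : ℚ, d ≠ 0 ∧ fMap^[n] (aSeq n) = (0, d) := by
  simpa using exists_iterate_fMap_smul_aSeq n one_ne_zero

theorem iterate_succ_fMap_aSeq (n : ℕ) : fMap^[n + 1] (aSeq n) = 0 := by
  obtain ⟨d, -, h⟩ := exists_iterate_fMap_aSeq n
  rw [Function.iterate_succ_apply', h]
  simp [fMap]

theorem fMap_zero : fMap 0 = 0 := by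
  simp [fMap]

theorem cancellation_fails_on_affine_plane :
    (∀ n : ℕ, 1 ≤ n →
      fMap^[n + 1] (aSeq n) = fMap^[n + 1] (aSeq ((n : ℤ) - 1)) ∧
      fMap^[n] (aSeq n) ≠ fMap^[n] (aSeq ((n : ℤ) - 1))) ∧
    ¬ ∃ s₀ : ℕ, ∀ x y : ℚ × ℚ,
        (∃ s : ℕ, fMap^[s] x = fMap^[s] y) → fMap^[s₀] x = fMap^[s₀] y := by
  have key : ∀ n : ℕ, 1 ≤ n →
      fMap^[n + 1] (aSeq n) = fMap^[n + 1] (aSeq ((n : ℤ) - 1)) ∧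
      fMap^[n] (aSeq n) ≠ fMap^[n] (aSeq ((n : ℤ) - 1)) := by
    rintro (_ | n) hn
    · omega
    have hpred : ((n + 1 : ℕ) : ℤ) - 1 = n := by omega
    rw [hpred]
    constructor
    · rw [iterate_succ_fMap_aSeq, Function.iterate_succ_apply', iterate_succ_fMap_aSeq, fMap_zero]
    · obtain ⟨d, hd, h⟩ := exists_iterate_fMap_aSeq (n + 1)
      rw [h, iterate_succ_fMap_aSeq]
      exact fun h₀ => hd (congrArg Prod.snd h₀)
  refine ⟨key, ?_⟩
  rintro ⟨s₀, hs₀⟩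
  obtain ⟨heq, hne⟩ := key (s₀ + 1) (by omega)
  apply hne
  rw [Function.iterate_succ_apply', Function.iterate_succ_apply', hs₀ _ _ ⟨_, heq⟩]
end

section
/- Let f : ℙ²_ℚ → ℙ²_ℚ be the morphism given by f(x : y : z) = (x² + yz : x² + y² + yz : z²). Then for every prime p (and also for p = ∞, i.e. over ℝ) and every integer n ≥ 1, there exist points a, b ∈ ℙ²(ℚ_p) such that f^{n}(a) = f^{n}(b) and f^{n−1}(a) ≠ f^{n−1}(b), where f is base-changed to ℚ_p. In particular, the cancellation statement fails for the base change of f to ℚ_p for every p ≤ ∞. -/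
/-!
STATEMENT 17: Let `f : ℙ²_ℚ → ℙ²_ℚ` be `f(x : y : z) = (x² + yz : x² + y² + yz : z²)`.  Then
for every prime `p` (and for `p = ∞`, i.e. over `ℝ`) and every `n ≥ 1` there are points
`a, b ∈ ℙ²(ℚ_p)` with `f^n(a) = f^n(b)` and `f^{n−1}(a) ≠ f^{n−1}(b)`.  In particular the
cancellation statement fails for the base change of `f` to `ℚ_p` for every `p ≤ ∞`.

Formalization notes.  The forms `x² + yz`, `x² + y² + yz`, `z²` have no common nontrivial zero
over any field, so `f` is a morphism; over a field `F`, points of `ℙ²(F)` are nonzero vectors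
in `F³` up to a nonzero scalar, and `f` is computed on representative vectors.
-/

/-- The self-map of `F³` inducing `f(x : y : z) = (x² + yz : x² + y² + yz : z²)` on `ℙ²(F)`. -/
def gMap (F : Type*) [CommRing F] : (Fin 3 → F) → (Fin 3 → F) := fun v =>
  ![v 0 ^ 2 + v 1 * v 2, v 0 ^ 2 + v 1 ^ 2 + v 1 * v 2, v 2 ^ 2]

/-- Equality in `ℙ²(F)` of the points represented by the vectors `v`, `w`. -/
def ProjEq (F : Type*) [CommRing F] (v w : Fin 3 → F) : Prop := ∃ c : F, c ≠ 0 ∧ w = c • v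

/-- The conclusion of the statement over the field `F`: for every `n ≥ 1` there are points of
`ℙ²(F)` that are identified by `f^n` but not by `f^{n−1}`; in particular the cancellation
statement fails over `F`. -/
def CancellationFailsFor (F : Type*) [Field F] : Prop :=
  (∀ n : ℕ, 1 ≤ n → ∃ a b : Fin 3 → F, a ≠ 0 ∧ b ≠ 0 ∧
      ProjEq F ((gMap F)^[n] a) ((gMap F)^[n] b) ∧
      ¬ ProjEq F ((gMap F)^[n - 1] a) ((gMap F)^[n - 1] b)) ∧
  ¬ ∃ s₀ : ℕ, ∀ a b : Fin 3 → F, a ≠ 0 → b ≠ 0 →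
      (∃ s : ℕ, ProjEq F ((gMap F)^[s] a) ((gMap F)^[s] b)) →
      ProjEq F ((gMap F)^[s₀] a) ((gMap F)^[s₀] b)

open Filter Topology in
/-- Over a complete field of characteristic `0`, elements close to `1` have square roots close
to `1`. -/
lemma exists_sq_eq_of_norm_lt (F : Type*) [NontriviallyNormedField F] [CompleteSpace F]
    [CharZero F] {ε : ℝ} (hε : 0 < ε) :
    ∃ δ > 0, ∀ t : F, ‖t‖ < δ → ∃ r : F, r ^ 2 = 1 + t ∧ ‖r - 1‖ < ε := by
  have hd : HasStrictDerivAt (fun x : F => x ^ 2) 2 1 := by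
    simpa using hasStrictDerivAt_pow 2 (1 : F)
  have hmap := hd.map_nhds_eq two_ne_zero
  have hmem : (fun x : F => x ^ 2) '' Metric.ball 1 ε ∈ 𝓝 ((1 : F) ^ 2) := by
    rw [← hmap]
    exact image_mem_map (Metric.ball_mem_nhds _ hε)
  obtain ⟨δ, hδ, hsub⟩ := Metric.mem_nhds_iff.1 hmem
  refine ⟨δ, hδ, fun t ht => ?_⟩
  obtain ⟨r, hr, hrt⟩ := hsub (show 1 + t ∈ Metric.ball ((1 : F) ^ 2) δ by
    simpa [dist_eq_norm] using ht)
  exact ⟨r, hrt, by simpa [dist_eq_norm] using hr⟩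

lemma gMap_affine {F : Type*} [CommRing F] (x y : F) :
    gMap F ![x, y, 1] = ![x ^ 2 + y, x ^ 2 + y ^ 2 + y, 1] := by
  simp [gMap]

lemma projEq_affine_iff {F : Type*} [Field F] (x y x' y' : F) :
    ProjEq F ![x, y, 1] ![x', y', 1] ↔ x' = x ∧ y' = y := by
  constructor
  · rintro ⟨c, -, h⟩
    have h2 := congrFun h 2
    simp only [Matrix.cons_val, Pi.smul_apply, smul_eq_mul, mul_one] at h2
    subst h2
    have h0 := congrFun h 0
    have h1 := congrFun h 1
    simp at h0 h1
    exact ⟨h0, h1⟩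
  · rintro ⟨rfl, rfl⟩
    exact ⟨1, one_ne_zero, by simp⟩

/-- Affine points close enough to the origin whose first coordinate is close to `-w ^ 4 ^ n`, and
whose second coordinate is comparatively small, lie in the image of the `n`-th iterate. -/
lemma exists_iterate_gMap_eq (F : Type*) [NontriviallyNormedField F] [CompleteSpace F]
    [CharZero F] (n : ℕ) :
    ∃ δ > 0, ∀ w α β : F, ‖w‖ < δ → ‖α‖ < δ → ‖β‖ < δ →
      ∃ x y : F, (gMap F)^[n] ![x, y, 1] = ![w ^ 4 ^ n * (α - 1), w ^ 4 ^ n * β, 1] := by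
  induction n with
  | zero => exact ⟨1, one_pos, fun w α β _ _ _ => ⟨_, _, rfl⟩⟩
  | succ n ih =>
    obtain ⟨δ₀, hδ₀, ih⟩ := ih
    obtain ⟨δ₁, hδ₁, h₁⟩ := exists_sq_eq_of_norm_lt F hδ₀
    obtain ⟨δ₂, hδ₂, h₂⟩ := exists_sq_eq_of_norm_lt F (lt_min one_pos (half_pos hδ₁))
    refine ⟨min (min 1 (δ₀ / 2)) (min (δ₁ / 4) (δ₂ / 2)), by positivity, fun w α β hw hα hβ => ?_⟩
    simp only [lt_min_iff] at hw hα hβ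
    set q := w ^ 4 ^ n with hq
    have hqw : ‖q‖ ≤ ‖w‖ := by
      rw [hq, norm_pow]
      exact pow_le_of_le_one (norm_nonneg _) hw.1.1.le (by positivity)
    obtain ⟨r, hr, hr1⟩ := h₂ (β - α) (by linarith [norm_sub_le β α])
    rw [lt_min_iff] at hr1
    have hα1 : ‖α - 1‖ ≤ 2 := by
      have := norm_sub_le α 1
      rw [norm_one] at this
      linarith
    have hqq : ‖q ^ 2 * (α - 1)‖ < δ₁ / 2 := by
      rw [norm_mul, norm_pow]
      nlinarith [norm_nonneg q, norm_nonneg (α - 1)]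
    obtain ⟨ρ, hρ, hρ1⟩ := h₁ (r - 1 + q ^ 2 * (α - 1))
      (by linarith [norm_add_le (r - 1) (q ^ 2 * (α - 1))])
    have hrn : ‖r‖ ≤ 2 := by
      have := norm_add_le (r - 1) 1
      rw [norm_one, sub_add_cancel] at this
      linarith
    obtain ⟨x, y, hxy⟩ := ih w (1 - ρ) (-(q * r)) (by linarith) (by rwa [norm_sub_rev]) (by
      rw [norm_neg, norm_mul]
      nlinarith [norm_nonneg q, norm_nonneg r])
    refine ⟨x, y, ?_⟩
    have hW : w ^ 4 ^ (n + 1) = q ^ 4 := by rw [hq, ← pow_mul, pow_succ]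
    rw [Function.iterate_succ_apply', hxy, gMap_affine, hW, ← hq]
    congr 1
    · linear_combination q ^ 2 * hρ
    · congr 1
      linear_combination q ^ 2 * hρ + q ^ 4 * hr

open Filter Topology in
theorem cancellationFailsFor_of_complete (F : Type*) [NontriviallyNormedField F]
    [CompleteSpace F] [CharZero F] : CancellationFailsFor F := by
  have key : ∀ m : ℕ, ∃ a b : Fin 3 → F, a ≠ 0 ∧ b ≠ 0 ∧
      ProjEq F ((gMap F)^[m + 1] a) ((gMap F)^[m + 1] b) ∧
      ¬ ProjEq F ((gMap F)^[m] a) ((gMap F)^[m] b) := by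
    intro m
    obtain ⟨δ, hδ, h⟩ := exists_iterate_gMap_eq F m
    set N := 4 ^ m with hN
    have hN0 : N ≠ 0 := by positivity
    obtain ⟨K, hK⟩ : ∃ K : F, 2 * K = (2 ^ N) ^ 2 - 1 :=
      ⟨((2 ^ N) ^ 2 - 1) / 2, mul_div_cancel₀ _ two_ne_zero⟩
    have small : ∀ g : F → F, Continuous g → g 0 = 0 → ∀ᶠ w in 𝓝[≠] (0 : F), ‖g w‖ < δ := by
      intro g hg h0
      have ht : Tendsto (fun w => ‖g w‖) (𝓝[≠] 0) (𝓝 0) :=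
        (hg.norm.tendsto' 0 0 (by simp [h0])).mono_left nhdsWithin_le_nhds
      exact ht.eventually_lt_const hδ
    obtain ⟨w, hw, hw1, hw2, hw3, hw0⟩ :=
      ((small (fun w => w) (by fun_prop) rfl).and
        ((small (fun w => 2 * w) (by fun_prop) (by simp)).and
        ((small (fun w => K * w ^ N) (by fun_prop) (by simp [hN0])).and
        ((small (fun w => -(K * w ^ N / 2 ^ N)) (by fun_prop) (by simp [hN0])).and
        self_mem_nhdsWithin)))).exists
    obtain ⟨x, y, hxy⟩ := h w 0 (K * w ^ N) hw (by simpa using hδ) hw2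
    obtain ⟨x', y', hxy'⟩ := h (2 * w) 0 (-(K * w ^ N / 2 ^ N)) hw1 (by simpa using hδ) hw3
    have hy' : (2 * w) ^ N * -(K * w ^ N / 2 ^ N) = -(K * (w ^ N) ^ 2) := by
      rw [mul_pow]
      field_simp
    rw [hy', mul_pow] at hxy'
    refine ⟨![x, y, 1], ![x', y', 1], fun h0 => by simpa using congrFun h0 2,
      fun h0 => by simpa using congrFun h0 2, ?_, ?_⟩
    · rw [Function.iterate_succ_apply', Function.iterate_succ_apply', hxy, hxy', gMap_affine,
        gMap_affine, projEq_affine_iff]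
      constructor
      · linear_combination -(w ^ N) ^ 2 * hK
      · linear_combination -(w ^ N) ^ 2 * hK
    · rw [hxy, hxy', projEq_affine_iff]
      rintro ⟨h0, -⟩
      have hwN : w ^ N ≠ 0 := pow_ne_zero _ hw0
      have h2 : (2 : F) ^ N = 1 := mul_right_cancel₀ hwN (by linear_combination -h0)
      have h2' : 2 ^ N = 1 := by exact_mod_cast h2
      exact (Nat.one_lt_two_pow hN0).ne' h2'
  refine ⟨fun n hn => ?_, ?_⟩
  · obtain ⟨m, rfl⟩ := Nat.exists_eq_add_of_le' hn
    exact key m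
  · rintro ⟨s₀, hs⟩
    obtain ⟨a, b, ha, hb, h1, h2⟩ := key s₀
    exact h2 (hs a b ha hb ⟨_, h1⟩)

theorem cancellation_fails_over_local_fields :
    (∀ (p : ℕ) (hp : Fact p.Prime), CancellationFailsFor ℚ_[p]) ∧ CancellationFailsFor ℝ :=
  ⟨fun p _ => cancellationFailsFor_of_complete ℚ_[p], cancellationFailsFor_of_complete ℝ⟩
end
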